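/- arXiv:math-ph/0511035 — 3 statements merged into one kernel-verified Lean document; each statement's English description precedes it below -/
import Mathlib

section
/- Let u, v : ℝ² → ℝ be smooth functions of (t,x). Then the identity e^x·v·(v_t − (sech²u)·u_x − tanh u) + (−e^x·tanh u)·(v_x − u_t) = D_t[e^x·(½v² + log(cosh u))] + D_x[−e^x·v·tanh u] holds at every point of ℝ²; i.e., [α,β] = [e^x V, −e^x tanh U] are multipliers yielding the conservation law with conserved densities [T,X] = [e^x(½v² + log(cosh u)), −e^x v·tanh u] for the nonlinear telegraph potential system with F(u) = sech²u, G(u) = tanh u. -/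
noncomputable section

/-- Partial derivative with respect to `t` of a function of `(t,x)`. -/
def Dt (w : ℝ → ℝ → ℝ) (t x : ℝ) : ℝ := deriv (fun s => w s x) t

/-- Partial derivative with respect to `x` of a function of `(t,x)`. -/
def Dx (w : ℝ → ℝ → ℝ) (t x : ℝ) : ℝ := deriv (fun s => w t s) x

/-- A section in `t` of a smooth function has derivative `Dt`. -/
theorem hasDerivAt_Dt {w : ℝ → ℝ → ℝ}
    (hw : ContDiff ℝ (⊤ : ℕ∞) fun p : ℝ × ℝ => w p.1 p.2) (t x : ℝ) :
    HasDerivAt (fun s => w s x) (Dt w t x) t := by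
  have h : ContDiff ℝ (⊤ : ℕ∞) fun s => w s x :=
    hw.comp (contDiff_id.prodMk contDiff_const)
  exact (h.differentiable (by simp) t).hasDerivAt

/-- A section in `x` of a smooth function has derivative `Dx`. -/
theorem hasDerivAt_Dx {w : ℝ → ℝ → ℝ}
    (hw : ContDiff ℝ (⊤ : ℕ∞) fun p : ℝ × ℝ => w p.1 p.2) (t x : ℝ) :
    HasDerivAt (fun s => w t s) (Dx w t x) x := by
  have h : ContDiff ℝ (⊤ : ℕ∞) fun s => w t s :=
    hw.comp (contDiff_const.prodMk contDiff_id)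
  exact (h.differentiable (by simp) x).hasDerivAt

theorem hasDerivAt_tanh (y : ℝ) :
    HasDerivAt Real.tanh ((1 / Real.cosh y) ^ 2) y := by
  have hc : Real.cosh y ≠ 0 := (Real.cosh_pos y).ne'
  have h := (Real.hasDerivAt_sinh y).div (Real.hasDerivAt_cosh y) hc
  rw [show Real.tanh = Real.sinh / Real.cosh from funext Real.tanh_eq_sinh_div_cosh]
  have e : (1 / Real.cosh y) ^ 2 =
      (Real.cosh y * Real.cosh y - Real.sinh y * Real.sinh y) / Real.cosh y ^ 2 := by
    rw [← sq, ← sq, Real.cosh_sq_sub_sinh_sq, div_pow, one_pow]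
  rwa [e]

/- STATEMENT 14: `[α,β] = [e^x V, −e^x tanh U]` are multipliers yielding the
   conservation law with densities `[T,X] = [e^x(½v² + log(cosh u)), −e^x v tanh u]`
   for the NLT potential system with `F(u) = sech²u`, `G(u) = tanh u`. -/
theorem stmt14 (u v : ℝ → ℝ → ℝ)
    (hu : ContDiff ℝ (⊤ : ℕ∞) fun p : ℝ × ℝ => u p.1 p.2)
    (hv : ContDiff ℝ (⊤ : ℕ∞) fun p : ℝ × ℝ => v p.1 p.2) :
    ∀ t x : ℝ,
      Real.exp x * v t x *
        (Dt v t x - (1 / Real.cosh (u t x)) ^ 2 * Dx u t x - Real.tanh (u t x)) +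
      (-Real.exp x * Real.tanh (u t x)) * (Dx v t x - Dt u t x) =
      Dt (fun t x => Real.exp x * ((1 / 2) * (v t x) ^ 2 +
          Real.log (Real.cosh (u t x)))) t x +
      Dx (fun t x => -Real.exp x * v t x * Real.tanh (u t x)) t x := by
  intro t x
  have hut : HasDerivAt (fun s => u s x) (Dt u t x) t := hasDerivAt_Dt hu t x
  have hux : HasDerivAt (fun s => u t s) (Dx u t x) x := hasDerivAt_Dx hu t x
  have hvt : HasDerivAt (fun s => v s x) (Dt v t x) t := hasDerivAt_Dt hv t x
  have hvx : HasDerivAt (fun s => v t s) (Dx v t x) x := hasDerivAt_Dx hv t x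
  have hc : Real.cosh (u t x) ≠ 0 := (Real.cosh_pos _).ne'
  have hT : Dt (fun t x => Real.exp x * ((1 / 2) * (v t x) ^ 2 +
      Real.log (Real.cosh (u t x)))) t x = _ :=
    ((((hvt.pow 2).const_mul (1 / 2)).add (hut.cosh.log hc)).const_mul (Real.exp x)).deriv
  have hX : Dx (fun t x => -Real.exp x * v t x * Real.tanh (u t x)) t x = _ :=
    (((Real.hasDerivAt_exp x).neg.mul hvx).mul
      ((hasDerivAt_tanh (u t x)).comp x hux)).deriv
  rw [hT, hX]
  simp only [Function.comp_apply, Pi.neg_apply, Pi.mul_apply, Real.tanh_eq_sinh_div_cosh]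
  field_simp
  ring
end
end

section
/- Let F(u) = sech²u and G(u) = tanh u, and define ξ(x,t,u,v) = tanh u, τ(x,t,u,v) = v, η(x,t,u,v) = 1, φ(x,t,u,v) = t. Then (ξ,τ,η,φ) satisfies all eight determining equations for point symmetries of the nonlinear telegraph potential system with coefficients (F,G), identically in (x,t,u,v) ∈ ℝ⁴; i.e., the generator X = v∂/∂t + (tanh u)∂/∂x + ∂/∂u + t∂/∂v is a point symmetry of this potential system. -/
noncomputable section

/-- Partial derivative in the first argument `x` of a function of `(x,t,u,v)`. -/
def pX (w : ℝ → ℝ → ℝ → ℝ → ℝ) (x t u v : ℝ) : ℝ := deriv (fun s => w s t u v) x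

/-- Partial derivative in the second argument `t`. -/
def pT (w : ℝ → ℝ → ℝ → ℝ → ℝ) (x t u v : ℝ) : ℝ := deriv (fun s => w x s u v) t

/-- Partial derivative in the third argument `u`. -/
def pU (w : ℝ → ℝ → ℝ → ℝ → ℝ) (x t u v : ℝ) : ℝ := deriv (fun s => w x t s v) u

/-- Partial derivative in the fourth argument `v`. -/
def pV (w : ℝ → ℝ → ℝ → ℝ → ℝ) (x t u v : ℝ) : ℝ := deriv (fun s => w x t u s) v

/-- The eight determining equations for a point symmetry
`X = ξ∂/∂x + τ∂/∂t + η∂/∂u + φ∂/∂v` of the nonlinear telegraph potential system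
`v_t − F(u)u_x − G(u) = 0`, `v_x − u_t = 0`, holding for all `(x,t,u,v) ∈ ℝ⁴`. -/
def DetEqs (F G : ℝ → ℝ) (ξ τ η φ : ℝ → ℝ → ℝ → ℝ → ℝ) : Prop :=
  ∀ x t u v : ℝ,
    pV ξ x t u v - pU τ x t u v = 0 ∧
    pU η x t u v - pV φ x t u v + pX ξ x t u v - pT τ x t u v = 0 ∧
    G u * (pV η x t u v + pX τ x t u v) + pT η x t u v - pX φ x t u v = 0 ∧
    pU ξ x t u v - F u * pV τ x t u v = 0 ∧
    pU φ x t u v - G u * pU τ x t u v - F u * pV η x t u v = 0 ∧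
    G u * pV ξ x t u v + pT ξ x t u v - F u * pX τ x t u v = 0 ∧
    F u * (pV φ x t u v - pT τ x t u v + pX ξ x t u v - pU η x t u v -
      2 * G u * pV τ x t u v) - deriv F u * η x t u v = 0 ∧
    G u * (pV φ x t u v - pT τ x t u v - G u * pV τ x t u v) -
      F u * pX η x t u v - deriv G u * η x t u v + pT φ x t u v = 0

theorem Real.hasDerivAt_tanh_one_div_cosh_sq (u : ℝ) :
    HasDerivAt Real.tanh ((1 / Real.cosh u) ^ 2) u := by
  have hc := (Real.cosh_pos u).ne'
  have h := (Real.hasDerivAt_sinh u).div (Real.hasDerivAt_cosh u) hc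
  rw [show Real.tanh = Real.sinh / Real.cosh from funext Real.tanh_eq_sinh_div_cosh]
  refine h.congr_deriv ?_
  field_simp
  linarith [Real.cosh_sq u]

theorem Real.hasDerivAt_one_div_cosh_sq (u : ℝ) :
    HasDerivAt (fun s => (1 / Real.cosh s) ^ 2)
      (-2 * Real.tanh u * (1 / Real.cosh u) ^ 2) u := by
  have hc := (Real.cosh_pos u).ne'
  have h := ((Real.hasDerivAt_cosh u).fun_inv hc).fun_pow 2
  simp only [one_div]
  refine h.congr_deriv ?_
  rw [Real.tanh_eq_sinh_div_cosh]
  norm_num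
  field_simp

/- STATEMENT 17: `X = v∂/∂t + (tanh u)∂/∂x + ∂/∂u + t∂/∂v` is a point symmetry
   of the NLT potential system with `F(u) = sech²u`, `G(u) = tanh u`. -/
theorem stmt17 :
    DetEqs (fun u => (1 / Real.cosh u) ^ 2) Real.tanh
      (fun _x _t u _v => Real.tanh u)
      (fun _x _t _u v => v)
      (fun _x _t _u _v => 1)
      (fun _x t _u _v => t) := by
  intro x t u v
  have hG := (Real.hasDerivAt_tanh_one_div_cosh_sq u).deriv
  have hF := (Real.hasDerivAt_one_div_cosh_sq u).deriv
  have hid : Real.tanh u ^ 2 + (1 / Real.cosh u) ^ 2 = 1 := by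
    have hc := (Real.cosh_pos u).ne'
    rw [Real.tanh_eq_sinh_div_cosh]
    field_simp
    linarith [Real.cosh_sq u]
  have hid1 : deriv (fun s : ℝ => s) t = 1 := deriv_id t
  have hid2 : deriv (fun s : ℝ => s) v = 1 := deriv_id v
  simp only [pX, pT, pU, pV, deriv_const, hG, hF, hid1, hid2]
  refine ⟨?_, ?_, ?_, ?_, ?_, ?_, ?_, ?_⟩
  all_goals first | ring1 | linear_combination -hid
end
end

section
/- Let A, B : ℝ² → ℝ be C¹ functions of (û,v) satisfying A_v + B_û = 0 and A_û + B_v − A = 0 on ℝ². Let F(u) = u^{−2}, G(u) = u^{−1}, and for u > 0 define û = x + log u and ξ(x,t,u,v) = −u^{−1}A(û,v), τ(x,t,u,v) = B(û,v), η(x,t,u,v) = A(û,v), φ(x,t,u,v) = 0. Then (ξ,τ,η,φ) satisfies all eight determining equations for point symmetries of the nonlinear telegraph potential system with coefficients (F,G), identically for all (x,t,v) ∈ ℝ³ and u > 0; i.e., X = −u^{−1}A(û,v)∂/∂x + B(û,v)∂/∂t + A(û,v)∂/∂u is a point symmetry of the potential system v_t − u^{−2}u_x − u^{−1} = 0, v_x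 − u_t = 0 whenever (A,B) solves the linear system A_v + B_û = 0, A_û + B_v − A = 0. -/
noncomputable section

/-- Partial derivative in the first argument of a function of two real variables. -/
def P1 (w : ℝ → ℝ → ℝ) (a b : ℝ) : ℝ := deriv (fun s => w s b) a

/-- Partial derivative in the second argument of a function of two real variables. -/
def P2 (w : ℝ → ℝ → ℝ) (a b : ℝ) : ℝ := deriv (fun s => w a s) b

/-- `F(u) = u^{−2}`. -/
def F18 : ℝ → ℝ := fun u => (u ^ 2)⁻¹

/-- `G(u) = u^{−1}`. -/
def G18 : ℝ → ℝ := fun u => u⁻¹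

/-- `ξ = −u^{−1} A(û,v)`, `û = x + log u`. -/
def ξ18 (A : ℝ → ℝ → ℝ) : ℝ → ℝ → ℝ → ℝ → ℝ :=
  fun x _t u v => -u⁻¹ * A (x + Real.log u) v

/-- `τ = B(û,v)`. -/
def τ18 (B : ℝ → ℝ → ℝ) : ℝ → ℝ → ℝ → ℝ → ℝ :=
  fun x _t u v => B (x + Real.log u) v

/-- `η = A(û,v)`. -/
def η18 (A : ℝ → ℝ → ℝ) : ℝ → ℝ → ℝ → ℝ → ℝ :=
  fun x _t u v => A (x + Real.log u) v

/-- `φ = 0`. -/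
def φ18 : ℝ → ℝ → ℝ → ℝ → ℝ := fun _x _t _u _v => 0

/-- A `C¹` function of two real variables is differentiable in its first argument. -/
theorem hasDerivAt_fst_of_contDiff {w : ℝ → ℝ → ℝ}
    (hw : ContDiff ℝ 1 fun p : ℝ × ℝ => w p.1 p.2) (a b : ℝ) :
    HasDerivAt (fun s => w s b) (P1 w a b) a := by
  have hd : Differentiable ℝ fun p : ℝ × ℝ => w p.1 p.2 := hw.differentiable one_ne_zero
  have h : Differentiable ℝ fun s : ℝ => w s b :=
    hd.comp (differentiable_id.prodMk (differentiable_const b))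
  exact (h a).hasDerivAt

/-- The chain rule for `x ↦ w (x + log u) v`. -/
theorem hasDerivAt_add_log_left {w : ℝ → ℝ → ℝ}
    (hw : ContDiff ℝ 1 fun p : ℝ × ℝ => w p.1 p.2) (x u v : ℝ) :
    HasDerivAt (fun s => w (s + Real.log u) v) (P1 w (x + Real.log u) v) x :=
  (hasDerivAt_fst_of_contDiff hw (x + Real.log u) v).comp_add_const x (Real.log u)

/-- The chain rule for `u ↦ w (x + log u) v`. -/
theorem hasDerivAt_add_log_right {w : ℝ → ℝ → ℝ}
    (hw : ContDiff ℝ 1 fun p : ℝ × ℝ => w p.1 p.2) (x v : ℝ) {u : ℝ} (hu : u ≠ 0) :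
    HasDerivAt (fun s => w (x + Real.log s) v) (P1 w (x + Real.log u) v * u⁻¹) u :=
  (hasDerivAt_fst_of_contDiff hw (x + Real.log u) v).comp (h₂ := fun s => w s v) u
    ((Real.hasDerivAt_log hu).const_add x)

/- STATEMENT 18: whenever `(A,B)` solves the linear system `A_v + B_û = 0`,
   `A_û + B_v − A = 0`, the generator `X = −u^{−1}A(û,v)∂/∂x + B(û,v)∂/∂t +
   A(û,v)∂/∂u` satisfies all eight determining equations for point symmetries of
   the potential system `v_t − u^{−2}u_x − u^{−1} = 0`, `v_x − u_t = 0`, for all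
   `(x,t,v) ∈ ℝ³` and `u > 0`. -/
theorem stmt18 (A B : ℝ → ℝ → ℝ)
    (hA : ContDiff ℝ 1 fun p : ℝ × ℝ => A p.1 p.2)
    (hB : ContDiff ℝ 1 fun p : ℝ × ℝ => B p.1 p.2)
    (h1 : ∀ uh v : ℝ, P2 A uh v + P1 B uh v = 0)
    (h2 : ∀ uh v : ℝ, P1 A uh v + P2 B uh v - A uh v = 0) :
    ∀ x t v u : ℝ, 0 < u →
      (pV (ξ18 A) x t u v - pU (τ18 B) x t u v = 0) ∧
      (pU (η18 A) x t u v - pV φ18 x t u v + pX (ξ18 A) x t u v -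
        pT (τ18 B) x t u v = 0) ∧
      (G18 u * (pV (η18 A) x t u v + pX (τ18 B) x t u v) + pT (η18 A) x t u v -
        pX φ18 x t u v = 0) ∧
      (pU (ξ18 A) x t u v - F18 u * pV (τ18 B) x t u v = 0) ∧
      (pU φ18 x t u v - G18 u * pU (τ18 B) x t u v -
        F18 u * pV (η18 A) x t u v = 0) ∧
      (G18 u * pV (ξ18 A) x t u v + pT (ξ18 A) x t u v -
        F18 u * pX (τ18 B) x t u v = 0) ∧
      (F18 u * (pV φ18 x t u v - pT (τ18 B) x t u v + pX (ξ18 A) x t u v -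
        pU (η18 A) x t u v - 2 * G18 u * pV (τ18 B) x t u v) -
        deriv F18 u * η18 A x t u v = 0) ∧
      (G18 u * (pV φ18 x t u v - pT (τ18 B) x t u v - G18 u * pV (τ18 B) x t u v) -
        F18 u * pX (η18 A) x t u v - deriv G18 u * η18 A x t u v +
        pT φ18 x t u v = 0) := by
  intro x t v u hu
  have hu0 : u ≠ 0 := hu.ne'
  have hξX : pX (ξ18 A) x t u v = -u⁻¹ * P1 A (x + Real.log u) v :=
    ((hasDerivAt_add_log_left hA x u v).const_mul (-u⁻¹)).deriv
  have hξT : pT (ξ18 A) x t u v = 0 := deriv_const _ _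
  have hξU : pU (ξ18 A) x t u v = (u ^ 2)⁻¹ * A (x + Real.log u) v +
      -u⁻¹ * (P1 A (x + Real.log u) v * u⁻¹) := by
    have h := ((hasDerivAt_inv hu0).neg.mul (hasDerivAt_add_log_right hA x v hu0)).deriv
    rw [neg_neg] at h
    exact h
  have hξV : pV (ξ18 A) x t u v = -u⁻¹ * P2 A (x + Real.log u) v :=
    deriv_const_mul_field _
  have hτX : pX (τ18 B) x t u v = P1 B (x + Real.log u) v :=
    (hasDerivAt_add_log_left hB x u v).deriv
  have hτT : pT (τ18 B) x t u v = 0 := deriv_const _ _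
  have hτU : pU (τ18 B) x t u v = P1 B (x + Real.log u) v * u⁻¹ :=
    (hasDerivAt_add_log_right hB x v hu0).deriv
  have hτV : pV (τ18 B) x t u v = P2 B (x + Real.log u) v := rfl
  have hηX : pX (η18 A) x t u v = P1 A (x + Real.log u) v :=
    (hasDerivAt_add_log_left hA x u v).deriv
  have hηT : pT (η18 A) x t u v = 0 := deriv_const _ _
  have hηU : pU (η18 A) x t u v = P1 A (x + Real.log u) v * u⁻¹ :=
    (hasDerivAt_add_log_right hA x v hu0).deriv
  have hηV : pV (η18 A) x t u v = P2 A (x + Real.log u) v := rfl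
  have hφX : pX φ18 x t u v = 0 := deriv_const _ _
  have hφT : pT φ18 x t u v = 0 := deriv_const _ _
  have hφU : pU φ18 x t u v = 0 := deriv_const _ _
  have hφV : pV φ18 x t u v = 0 := deriv_const _ _
  have hη : η18 A x t u v = A (x + Real.log u) v := rfl
  have hF : F18 u = u⁻¹ ^ 2 := (inv_pow u 2).symm
  have hG : G18 u = u⁻¹ := rfl
  have hF' : deriv F18 u = -2 * u⁻¹ ^ 3 := by
    have h : deriv F18 u = _ := ((hasDerivAt_pow 2 u).inv (pow_ne_zero 2 hu0)).deriv
    rw [h]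
    push_cast
    field_simp
  have hG' : deriv G18 u = -u⁻¹ ^ 2 := by
    have h : deriv G18 u = _ := (hasDerivAt_inv hu0).deriv
    rw [h, inv_pow]
  have e1 := h1 (x + Real.log u) v
  have e2 := h2 (x + Real.log u) v
  rw [hξX, hξT, hξU, hξV, hτX, hτT, hτU, hτV, hηX, hηT, hηU, hηV, hφX, hφT, hφU, hφV, hη,
    hF, hG, hF', hG', ← inv_pow]
  refine ⟨?_, ?_, ?_, ?_, ?_, ?_, ?_, ?_⟩
  · linear_combination -u⁻¹ * e1
  · ring
  · linear_combination u⁻¹ * e1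
  · linear_combination -u⁻¹ ^ 2 * e2
  · linear_combination -u⁻¹ ^ 2 * e1
  · linear_combination -u⁻¹ ^ 2 * e1
  · linear_combination -2 * u⁻¹ ^ 3 * e2
  · linear_combination -u⁻¹ ^ 2 * e2
end
end
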